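/- arXiv:1801.01291 — 3 statements merged into one kernel-verified Lean document; each statement's English description precedes it below -/
import Mathlib

section
/- (The Galerkin approximation solves a perturbed NDRE.) Under the hypotheses of the factored residual statement — A𝒱 = 𝒱 T_A + V₊ B_A, 𝒲ᵀD = T_D 𝒲ᵀ + B_Dᵀ W₊ᵀ, 𝒱ᵀ𝒱 = I, 𝒲ᵀ𝒲 = I, F = 𝒱(𝒱ᵀF), G = 𝒲(𝒲ᵀG), and Y solving the projected equation Ẏ = −T_A Y − Y T_D + Y S_m Y + (𝒱ᵀF)(𝒲ᵀG)ᵀ with S_m = 𝒲ᵀS𝒱 — define Δ_A := V₊ B_A 𝒱ᵀ ∈ ℝ^{n×n} and Δ_D := 𝒲 B_Dᵀ W₊ᵀ ∈ ℝ^{p×p}, and set X_m(t) = 𝒱 Y(t) 𝒲ᵀ. Then X_m satisfies the perturbed differential Riccati equation Ẋ_m(t) = −(A − Δ_A) X_m(t) − X_m(t)(D − Δ_D) + X_m(t) S X_m(t) + F Gᵀ for every t. -/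
/- STATEMENT 11: the Galerkin approximation X_m(t) = 𝒱 Y(t) 𝒲ᵀ solves the
perturbed differential Riccati equation
Ẋ_m = −(A − Δ_A) X_m − X_m (D − Δ_D) + X_m S X_m + F Gᵀ,
with Δ_A = V₊ B_A 𝒱ᵀ and Δ_D = 𝒲 B_Dᵀ W₊ᵀ. -/

attribute [local instance] Matrix.normedAddCommGroup Matrix.normedSpace

open Matrix

/-- The entrywise derivative of a matrix function commutes with multiplication by constant matrices
on both sides. -/
theorem hasDerivAt_const_mul_mul_const {m n k l : ℕ}
    (P : Matrix (Fin m) (Fin k) ℝ) (Q : Matrix (Fin l) (Fin n) ℝ)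
    {Y : ℝ → Matrix (Fin k) (Fin l) ℝ} {Y' : Matrix (Fin k) (Fin l) ℝ} {t : ℝ}
    (hY : HasDerivAt Y Y' t) : HasDerivAt (fun u => P * Y u * Q) (P * Y' * Q) t := by
  let L : Matrix (Fin k) (Fin l) ℝ →ₗ[ℝ] Matrix (Fin m) (Fin n) ℝ :=
    { toFun := fun Z => P * Z * Q
      map_add' := fun Z₁ Z₂ => by rw [Matrix.mul_add, Matrix.add_mul]
      map_smul' := fun c Z => by simp }
  exact (LinearMap.toContinuousLinearMap L).hasFDerivAt.comp_hasDerivAt t hY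

theorem galerkin_solves_perturbed_ndre
    (n p s k l r r' : ℕ)
    (A : Matrix (Fin n) (Fin n) ℝ) (D : Matrix (Fin p) (Fin p) ℝ)
    (S : Matrix (Fin p) (Fin n) ℝ)
    (F : Matrix (Fin n) (Fin s) ℝ) (G : Matrix (Fin p) (Fin s) ℝ)
    (V : Matrix (Fin n) (Fin k) ℝ) (Vp : Matrix (Fin n) (Fin r) ℝ)
    (W : Matrix (Fin p) (Fin l) ℝ) (Wp : Matrix (Fin p) (Fin r') ℝ)
    (BA : Matrix (Fin r) (Fin k) ℝ) (BD : Matrix (Fin r') (Fin l) ℝ)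
    (hV : Vᵀ * V = 1) (hW : Wᵀ * W = 1)
    (hA : A * V = V * (Vᵀ * A * V) + Vp * BA)
    (hD : Wᵀ * D = (Wᵀ * D * W) * Wᵀ + BDᵀ * Wpᵀ)
    (hF : F = V * (Vᵀ * F)) (hG : G = W * (Wᵀ * G))
    (Y Y' : ℝ → Matrix (Fin k) (Fin l) ℝ)
    (hYderiv : ∀ t, HasDerivAt Y (Y' t) t)
    (hYeq : ∀ t, Y' t = -((Vᵀ * A * V) * Y t) - Y t * (Wᵀ * D * W)
      + Y t * (Wᵀ * S * V) * Y t + (Vᵀ * F) * (Wᵀ * G)ᵀ) :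
    ∀ t, HasDerivAt (fun u => V * Y u * Wᵀ)
      (-((A - Vp * BA * Vᵀ) * (V * Y t * Wᵀ))
        - (V * Y t * Wᵀ) * (D - W * BDᵀ * Wpᵀ)
        + (V * Y t * Wᵀ) * S * (V * Y t * Wᵀ) + F * Gᵀ) t := by
  intro t
  have hAV : (A - Vp * BA * Vᵀ) * V = V * (Vᵀ * A * V) := by
    rw [Matrix.sub_mul, Matrix.mul_assoc (Vp * BA), hV, Matrix.mul_one, hA, add_sub_cancel_right]
  have hWD : Wᵀ * (D - W * BDᵀ * Wpᵀ) = (Wᵀ * D * W) * Wᵀ := by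
    rw [Matrix.mul_sub, Matrix.mul_assoc W, ← Matrix.mul_assoc Wᵀ W, hW, Matrix.one_mul,
      sub_eq_iff_eq_add]
    exact hD
  have hFG : F * Gᵀ = V * ((Vᵀ * F) * (Wᵀ * G)ᵀ) * Wᵀ := by
    conv_lhs => rw [hF, hG, Matrix.transpose_mul W]
    simp only [Matrix.mul_assoc]
  have hleft : (A - Vp * BA * Vᵀ) * (V * Y t * Wᵀ) = V * ((Vᵀ * A * V) * Y t) * Wᵀ := by
    rw [← Matrix.mul_assoc, ← Matrix.mul_assoc, hAV, Matrix.mul_assoc V]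
  have hright : (V * Y t * Wᵀ) * (D - W * BDᵀ * Wpᵀ) = V * (Y t * (Wᵀ * D * W)) * Wᵀ := by
    rw [Matrix.mul_assoc (V * Y t), hWD]
    simp only [Matrix.mul_assoc]
  have hquad : (V * Y t * Wᵀ) * S * (V * Y t * Wᵀ)
      = V * (Y t * (Wᵀ * S * V) * Y t) * Wᵀ := by
    simp only [Matrix.mul_assoc]
  have hderiv := hasDerivAt_const_mul_mul_const V Wᵀ (hYderiv t)
  rw [hYeq t] at hderiv
  rw [hleft, hright, hquad, hFG]
  simpa only [Matrix.mul_add, Matrix.mul_sub, Matrix.mul_neg, Matrix.add_mul, Matrix.sub_mul,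
    Matrix.neg_mul] using hderiv
end

section
/- (Residual identity via perturbation matrices.) Under the hypotheses of the factored residual statement — A𝒱 = 𝒱 T_A + V₊ B_A, 𝒲ᵀD = T_D 𝒲ᵀ + B_Dᵀ W₊ᵀ, 𝒱ᵀ𝒱 = I, 𝒲ᵀ𝒲 = I, F = 𝒱(𝒱ᵀF), G = 𝒲(𝒲ᵀG), and Y solving the projected equation Ẏ = −T_A Y − Y T_D + Y S_m Y + (𝒱ᵀF)(𝒲ᵀG)ᵀ with S_m = 𝒲ᵀS𝒱 — define Δ_A := V₊ B_A 𝒱ᵀ and Δ_D := 𝒲 B_Dᵀ W₊ᵀ, and set X_m(t) = 𝒱 Y(t) 𝒲ᵀ. Then the residual R_m(t) = Ẋ_m(t) + A X_m(t) + X_m(t) D − X_m(t) S X_m(t) − F Gᵀ satisfies R_m(t) = Δ_A X_m(t) + X_m(t) Δ_D for every t. -/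
/- STATEMENT 12: residual identity via the perturbation matrices:
R_m(t) = Δ_A X_m(t) + X_m(t) Δ_D, where Δ_A = V₊ B_A 𝒱ᵀ, Δ_D = 𝒲 B_Dᵀ W₊ᵀ. -/

attribute [local instance] Matrix.normedAddCommGroup Matrix.normedSpace

open Matrix

theorem residual_eq_perturbation
    (n p s k l r r' : ℕ)
    (A : Matrix (Fin n) (Fin n) ℝ) (D : Matrix (Fin p) (Fin p) ℝ)
    (S : Matrix (Fin p) (Fin n) ℝ)
    (F : Matrix (Fin n) (Fin s) ℝ) (G : Matrix (Fin p) (Fin s) ℝ)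
    (V : Matrix (Fin n) (Fin k) ℝ) (Vp : Matrix (Fin n) (Fin r) ℝ)
    (W : Matrix (Fin p) (Fin l) ℝ) (Wp : Matrix (Fin p) (Fin r') ℝ)
    (BA : Matrix (Fin r) (Fin k) ℝ) (BD : Matrix (Fin r') (Fin l) ℝ)
    (hV : Vᵀ * V = 1) (hW : Wᵀ * W = 1)
    (hA : A * V = V * (Vᵀ * A * V) + Vp * BA)
    (hD : Wᵀ * D = (Wᵀ * D * W) * Wᵀ + BDᵀ * Wpᵀ)
    (hF : F = V * (Vᵀ * F)) (hG : G = W * (Wᵀ * G))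
    (Y Y' : ℝ → Matrix (Fin k) (Fin l) ℝ)
    (hYderiv : ∀ t, HasDerivAt Y (Y' t) t)
    (hYeq : ∀ t, Y' t = -((Vᵀ * A * V) * Y t) - Y t * (Wᵀ * D * W)
      + Y t * (Wᵀ * S * V) * Y t + (Vᵀ * F) * (Wᵀ * G)ᵀ) :
    ∀ t, V * Y' t * Wᵀ
        + A * (V * Y t * Wᵀ) + (V * Y t * Wᵀ) * D
        - (V * Y t * Wᵀ) * S * (V * Y t * Wᵀ) - F * Gᵀ
      = (Vp * BA * Vᵀ) * (V * Y t * Wᵀ) + (V * Y t * Wᵀ) * (W * BDᵀ * Wpᵀ) := by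
  intro t
  have hAX : A * (V * Y t * Wᵀ)
      = V * ((Vᵀ * A * V) * Y t) * Wᵀ + (Vp * BA) * (Y t * Wᵀ) := by
    rw [Matrix.mul_assoc V, ← Matrix.mul_assoc A, hA, Matrix.add_mul]
    simp only [Matrix.mul_assoc]
  have hXD : (V * Y t * Wᵀ) * D
      = V * (Y t * (Wᵀ * D * W)) * Wᵀ + (V * Y t) * (BDᵀ * Wpᵀ) := by
    conv_lhs => rw [Matrix.mul_assoc _ Wᵀ, hD, Matrix.mul_add]
    simp only [Matrix.mul_assoc]
  have hFG : F * Gᵀ = V * ((Vᵀ * F) * (Wᵀ * G)ᵀ) * Wᵀ := by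
    conv_lhs => rw [hF, hG, Matrix.transpose_mul W]
    simp only [Matrix.mul_assoc]
  have hXSX : (V * Y t * Wᵀ) * S * (V * Y t * Wᵀ)
      = V * (Y t * (Wᵀ * S * V) * Y t) * Wᵀ := by
    simp only [Matrix.mul_assoc]
  have hΔA : (Vp * BA * Vᵀ) * (V * Y t * Wᵀ) = (Vp * BA) * (Y t * Wᵀ) := by
    rw [Matrix.mul_assoc V, Matrix.mul_assoc _ Vᵀ, ← Matrix.mul_assoc Vᵀ, hV, Matrix.one_mul]
  have hΔD : (V * Y t * Wᵀ) * (W * BDᵀ * Wpᵀ) = (V * Y t) * (BDᵀ * Wpᵀ) := by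
    rw [Matrix.mul_assoc W, Matrix.mul_assoc _ Wᵀ, ← Matrix.mul_assoc Wᵀ, hW, Matrix.one_mul]
  rw [hAX, hXD, hFG, hXSX, hΔA, hΔD, hYeq t]
  simp only [Matrix.mul_add, Matrix.mul_sub, Matrix.mul_neg, Matrix.add_mul, Matrix.sub_mul,
    Matrix.neg_mul]
  abel
end

section
/- (Global solution of the transport-theory NDRE and convergence to the minimal solution.) Let n ≥ 1, let 0 < c ≤ 1 and 0 ≤ α < 1 be real parameters, and let (ωᵢ)_{i=1}^n and (cᵢ)_{i=1}^n be the nodes and weights of the Gauss–Legendre quadrature on [0,1], so that 0 < ω_n < … < ω₁ < 1, cᵢ > 0, and Σ_{i=1}^n cᵢ = 1. Define Δ = diag(δ₁, …, δ_n) and Γ = diag(γ₁, …, γ_n) with δᵢ = 1/(c ωᵢ (1+α)) and γᵢ = 1/(c ωᵢ (1−α)); let e = (1, …, 1)ᵀ ∈ ℝⁿ and q = (q₁, …, q_n)ᵀ with qᵢ = cᵢ/(2ωᵢ). Let X_min be the minimal nonnegative solution of the algebraic equation −(Δ − e qᵀ) X − X (Γ − q eᵀ) + X q qᵀ X + e eᵀ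 = 0. Assume X0 ∈ ℝ^{n×n} satisfies 0 ≤ X0 ≤ X_min entrywise and e eᵀ − Δ X0 − X0 Γ ≥ 0 entrywise. Then there exists a differentiable global solution X : [0, ∞) → ℝ^{n×n} of Ẋ(t) = −(Δ − e qᵀ) X(t) − X(t)(Γ − q eᵀ) + X(t) q qᵀ X(t) + e eᵀ with X(0) = X0; X(t) is entrywise nondecreasing in t on [0, ∞); and X(t) → X_min as t → ∞. -/
/- STATEMENT 19: global solution of the transport-theory NDRE, monotonicity
in t, and convergence to the minimal nonnegative solution X_min of the
associated nonsymmetric algebraic Riccati equation. -/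

attribute [local instance] Matrix.normedAddCommGroup Matrix.normedSpace

open Matrix

open Set Filter Topology in
/-- A bounded Lipschitz autonomous vector field has a solution defined for all times. -/
theorem exists_forall_hasDerivAt_of_lipschitzWith_of_bounded
    {E : Type*} [NormedAddCommGroup E] [NormedSpace ℝ E] [CompleteSpace E]
    {g : E → E} {K M : NNReal} (hg : LipschitzWith K g) (hM : ∀ x, ‖g x‖ ≤ M) (x₀ : E) :
    ∃ x : ℝ → E, x 0 = x₀ ∧ ∀ t, HasDerivAt x (g (x t)) t := by
  have hloc (N : ℕ) : ∃ x : ℝ → E, x 0 = x₀ ∧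
      ∀ t ∈ Ioo (-(N : ℝ)) N, HasDerivAt x (g (x t)) t := by
    have h0 : (0 : ℝ) ∈ Icc (-(N : ℝ)) N := by simp
    have hpl : IsPicardLindelof (fun _ ↦ g) (⟨0, h0⟩ : Icc (-(N : ℝ)) N) x₀ (M * N) 0 M K :=
      .of_time_independent (fun x _ ↦ hM x) hg.lipschitzOnWith (by simp)
    obtain ⟨x, hx0, hx⟩ := hpl.exists_eq_forall_mem_Icc_hasDerivWithinAt₀
    exact ⟨x, hx0, fun t ht ↦
      (hx t (Ioo_subset_Icc_self ht)).hasDerivAt (Icc_mem_nhds ht.1 ht.2)⟩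
  choose y hy0 hy using hloc
  have hsub {M N : ℕ} (hMN : M ≤ N) : Ioo (-(M : ℝ)) M ⊆ Ioo (-(N : ℝ)) N := by
    have : (M : ℝ) ≤ N := by exact_mod_cast hMN
    exact Ioo_subset_Ioo (by linarith) this
  have hmono {M N : ℕ} (hMN : M ≤ N) : EqOn (y M) (y N) (Ioo (-(M : ℝ)) M) := by
    intro t ht
    have hM0 : (0 : ℝ) < M := by linarith [ht.1, ht.2]
    exact ODE_solution_unique_of_mem_Ioo (v := fun _ ↦ g) (s := fun _ ↦ univ) (K := K)
      (t₀ := 0) (fun _ _ ↦ hg.lipschitzOnWith) ⟨by linarith, hM0⟩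
      (fun s hs ↦ ⟨hy M s hs, mem_univ _⟩) (fun s hs ↦ ⟨hy N s (hsub hMN hs), mem_univ _⟩)
      (by rw [hy0, hy0]) ht
  have hmem (t : ℝ) : t ∈ Ioo (-((⌊|t|⌋₊ + 1 : ℕ) : ℝ)) (⌊|t|⌋₊ + 1 : ℕ) := by
    have := Nat.lt_floor_add_one |t|
    push_cast
    exact abs_lt.1 this
  have heq (N : ℕ) : EqOn (fun t ↦ y (⌊|t|⌋₊ + 1) t) (y N) (Ioo (-(N : ℝ)) N) := by
    intro t ht
    rcases le_total (⌊|t|⌋₊ + 1) N with h | h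
    · exact hmono h (hmem t)
    · exact (hmono h ht).symm
  refine ⟨fun t ↦ y (⌊|t|⌋₊ + 1) t, hy0 _, fun t ↦ ?_⟩
  exact (hy _ t (hmem t)).congr_of_eventuallyEq
    ((heq _).eventuallyEq_of_mem (Ioo_mem_nhds (hmem t).1 (hmem t).2))

open Set in
/-- A continuous function passing from nonnegative to negative values has a last time at which it is
nonnegative. -/
theorem Continuous.exists_last_nonneg {u : ℝ → ℝ} (hu : Continuous u) {t₀ t₁ : ℝ}
    (h01 : t₀ ≤ t₁) (h₀ : 0 ≤ u t₀) (h₁ : u t₁ < 0) :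
    ∃ s, t₀ ≤ s ∧ s < t₁ ∧ 0 ≤ u s ∧ ∀ r ∈ Ioc s t₁, u r < 0 := by
  have hcomp : IsCompact (Icc t₀ t₁ ∩ {r | 0 ≤ u r}) :=
    isCompact_Icc.inter_right (isClosed_le continuous_const hu)
  obtain ⟨s, ⟨hs, hus⟩, hmax⟩ := hcomp.exists_isGreatest ⟨t₀, ⟨le_rfl, h01⟩, h₀⟩
  refine ⟨s, hs.1, lt_of_le_of_ne hs.2 ?_, hus, fun r hr ↦ ?_⟩
  · rintro rfl
    exact absurd h₁ (not_lt.2 hus)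
  · by_contra! hur
    exact absurd (hmax ⟨⟨hs.1.trans hr.1.le, hr.2⟩, hur⟩) (not_le.2 hr.1)

open Set in
/-- A function whose derivative vanishes on a half-open interval has equal values at its ends. -/
theorem eq_endpoints_of_hasDerivAt_zero {u u' : ℝ → ℝ} (hu : ∀ t, HasDerivAt u (u' t) t)
    {s t : ℝ} (hst : s < t) (hu' : ∀ r ∈ Ioc s t, u' r = 0) : u s = u t := by
  obtain ⟨r, hr, hrr⟩ := exists_hasDerivAt_eq_slope u u' hst
    (fun r _ ↦ (hu r).continuousAt.continuousWithinAt) (fun r _ ↦ hu r)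
  rw [hu' r ⟨hr.1, hr.2.le⟩, eq_comm, div_eq_zero_iff] at hrr
  rcases hrr with h | h <;> linarith

open Set in
/-- Truncating the argument of a Lipschitz field to a box, and its values to the positive orthant,
gives a bounded Lipschitz field. -/
theorem exists_lipschitzWith_bounded_truncation {ι : Type*} [Fintype ι]
    {f : (ι → ℝ) → ι → ℝ} (hf : ContDiff ℝ 1 f) {a b : ι → ℝ} (hab : a ≤ b) :
    ∃ K M : NNReal, LipschitzWith K (fun x ↦ f (a ⊔ x ⊓ b) ⊔ 0) ∧
      ∀ x, ‖f (a ⊔ x ⊓ b) ⊔ 0‖ ≤ M := by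
  obtain ⟨K, hK⟩ := hf.contDiffOn.exists_lipschitzOnWith one_ne_zero (convex_Icc a b) isCompact_Icc
  obtain ⟨M, hM⟩ := isCompact_Icc.exists_bound_of_continuousOn
    (hf.continuous.continuousOn (s := Icc a b))
  have hmem (x : ι → ℝ) : a ⊔ x ⊓ b ∈ Icc a b := ⟨le_sup_left, sup_le hab inf_le_right⟩
  refine ⟨K, M.toNNReal, LipschitzWith.of_dist_le_mul fun x y ↦ ?_, fun x ↦ ?_⟩
  · have hclamp : dist (a ⊔ x ⊓ b) (a ⊔ y ⊓ b) ≤ dist x y := by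
      refine (dist_pi_le_iff dist_nonneg).2 fun i ↦ le_trans ?_ (dist_le_pi_dist x y i)
      simp only [Pi.sup_apply, Pi.inf_apply, Real.dist_eq]
      refine (abs_max_sub_max_le_max _ _ _ _).trans ?_
      refine max_le (by simp) ((abs_min_sub_min_le_max _ _ _ _).trans (by simp))
    refine le_trans ?_ ((hK.dist_le_mul _ (hmem x) _ (hmem y)).trans (by gcongr))
    refine (dist_pi_le_iff dist_nonneg).2 fun i ↦ le_trans ?_ (dist_le_pi_dist _ _ i)
    simp only [Pi.sup_apply, Pi.zero_apply, Real.dist_eq]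
    exact (abs_max_sub_max_le_max _ _ _ _).trans (by simp)
  · refine le_trans ?_ ((hM _ (hmem x)).trans (Real.le_coe_toNNReal M))
    refine (pi_norm_le_iff_of_nonneg (norm_nonneg _)).2 fun i ↦
      le_trans ?_ (norm_le_pi_norm _ i)
    simp only [Pi.sup_apply, Pi.zero_apply, Real.norm_eq_abs]
    rw [abs_of_nonneg (le_max_right _ _)]
    exact max_le (le_abs_self _) (abs_nonneg _)

open Set Filter Topology in
/-- A quasimonotone autonomous system started at a subsolution `a` lying below a supersolution `b`
has a global solution, which is nondecreasing and converges to a steady state between `a` and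
`b`. -/
theorem exists_monotone_solution_of_quasimonotone {ι : Type*} [Fintype ι]
    {f : (ι → ℝ) → ι → ℝ} (hf : ContDiff ℝ 1 f) {a b : ι → ℝ} (hab : a ≤ b)
    (hquasi : ∀ x y i, a ≤ x → x ≤ y → y ≤ b → x i = y i → f x i ≤ f y i)
    (ha : 0 ≤ f a) (hb : f b ≤ 0) :
    ∃ x : ℝ → ι → ℝ, x 0 = a ∧ (∀ t, 0 ≤ t → HasDerivAt x (f (x t)) t) ∧
      Monotone x ∧ ∃ l ∈ Icc a b, f l = 0 ∧ Tendsto x atTop (𝓝 l) := by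
  obtain ⟨K, M, hK, hM⟩ := exists_lipschitzWith_bounded_truncation hf hab
  obtain ⟨x, hx0, hx⟩ := exists_forall_hasDerivAt_of_lipschitzWith_of_bounded hK hM a
  have hxi (i : ι) (t : ℝ) : HasDerivAt (fun t ↦ x t i) (max (f (a ⊔ x t ⊓ b) i) 0) t :=
    hasDerivAt_pi.1 (hx t) i
  have hcont : Continuous x := continuous_iff_continuousAt.2 fun t ↦ (hx t).continuousAt
  have hmono : Monotone x := fun s t hst i ↦
    monotone_of_hasDerivAt_nonneg (hxi i) (fun t ↦ le_max_right _ _) hst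
  have hlow {t : ℝ} (ht : 0 ≤ t) : a ≤ x t := hx0 ▸ hmono ht
  have hup {t : ℝ} (ht : 0 ≤ t) : x t ≤ b := by
    intro i
    by_contra! hlt
    obtain ⟨s, hs0, hst, hs, hsr⟩ := Continuous.exists_last_nonneg
      (u := fun t ↦ b i - x t i) (by fun_prop) ht
      (by simpa [hx0] using hab i) (by linarith)
    have := eq_endpoints_of_hasDerivAt_zero (hxi i) hst fun r hr ↦ by
      have hbi : b i ≤ x r i := by linarith [hsr r hr]
      refine max_eq_right (le_trans ?_ (hb i))
      refine hquasi _ _ i le_sup_left (sup_le hab inf_le_right) le_rfl ?_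
      simp [hbi, hab i]
    linarith
  have hclamp {t : ℝ} (ht : 0 ≤ t) : a ⊔ x t ⊓ b = x t := by
    rw [inf_eq_left.2 (hup ht), sup_eq_right.2 (hlow ht)]
  have hfcont : Continuous fun t ↦ f (x t) := hf.continuous.comp hcont
  have hnonneg {t : ℝ} (ht : 0 ≤ t) : 0 ≤ f (x t) := by
    intro i
    by_contra! hlt
    obtain ⟨s, hs0, hst, hs, hsr⟩ := Continuous.exists_last_nonneg
      (u := fun t ↦ f (x t) i) (by fun_prop) ht (by simpa [hx0] using ha i) hlt
    have heq := eq_endpoints_of_hasDerivAt_zero (hxi i) hst fun r hr ↦ by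
      rw [hclamp (hs0.trans hr.1.le)]
      exact max_eq_right (hsr r hr).le
    have := hquasi (x s) (x t) i (hlow hs0) (hmono hst.le) (hup ht) heq
    exact absurd hlt (not_lt.2 (hs.trans this))
  have hderiv (t : ℝ) (ht : 0 ≤ t) : HasDerivAt x (f (x t)) t := by
    have := hx t
    rwa [hclamp ht, sup_eq_left.2 (hnonneg ht)] at this
  have hbdd (i : ι) : BddAbove (range fun t ↦ x t i) := by
    refine ⟨b i, ?_⟩
    rintro _ ⟨t, rfl⟩
    exact (hmono (le_max_left t 0) i).trans (hup (le_max_right t 0) i)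
  have hlim : Tendsto x atTop (𝓝 fun i ↦ ⨆ t, x t i) :=
    tendsto_pi_nhds.2 fun i ↦ tendsto_atTop_ciSup (fun s t hst ↦ hmono hst i) (hbdd i)
  refine ⟨x, hx0, hderiv, hmono, _, ⟨?_, ?_⟩, ?_, hlim⟩
  · exact ge_of_tendsto hlim ((eventually_ge_atTop 0).mono fun t ht ↦ hlow ht)
  · exact le_of_tendsto hlim ((eventually_ge_atTop 0).mono fun t ht ↦ hup ht)
  · set l := fun i ↦ ⨆ t, x t i
    funext i
    have hmvt (k : ℕ) : ∃ r : ℝ, (k : ℝ) ≤ r ∧ f (x r) i = x (k + 1) i - x k i := by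
      obtain ⟨r, hr, hrr⟩ := exists_hasDerivAt_eq_slope (fun t ↦ x t i) (fun t ↦ f (x t) i)
        (lt_add_one (k : ℝ)) (fun r _ ↦ (hxi i r).continuousAt.continuousWithinAt)
        (fun r hr ↦ hasDerivAt_pi.1 (hderiv r ((Nat.cast_nonneg k).trans hr.1.le)) i)
      exact ⟨r, hr.1.le, by simpa using hrr⟩
    choose r hkr hr using hmvt
    have hrtop : Tendsto r atTop atTop := tendsto_atTop_mono hkr tendsto_natCast_atTop_atTop
    have h1 : Tendsto (fun k ↦ f (x (r k)) i) atTop (𝓝 (f l i)) :=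
      ((continuous_apply i).comp hf.continuous).continuousAt.tendsto.comp (hlim.comp hrtop)
    have hli := tendsto_pi_nhds.1 hlim i
    have h2 : Tendsto (fun k : ℕ ↦ x (k + 1) i - x k i) atTop (𝓝 (l i - l i)) :=
      (hli.comp (tendsto_atTop_add_const_right _ 1 tendsto_natCast_atTop_atTop)).sub
        (hli.comp tendsto_natCast_atTop_atTop)
    rw [sub_self] at h2
    exact tendsto_nhds_unique h1 (by simpa only [hr, Pi.zero_apply] using h2)

/-- Entries of the transport Riccati operator. -/
theorem transport_riccati_apply {ι : Type*} [Fintype ι] [DecidableEq ι]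
    (d g q : ι → ℝ) (X : Matrix ι ι ℝ) (i j : ι) :
    (-((diagonal d - vecMulVec (fun _ => 1) q) * X) - X * (diagonal g - vecMulVec q fun _ => 1)
        + X * vecMulVec q q * X + vecMulVec (fun _ => 1) (fun _ => 1) : Matrix ι ι ℝ) i j
      = (1 + ∑ k, X i k * q k) * (1 + ∑ k, q k * X k j) - (d i + g j) * X i j := by
  simp only [sub_mul, mul_sub, vecMulVec_mul, mul_vecMulVec, Matrix.add_apply, Matrix.sub_apply, Matrix.neg_apply,
    diagonal_mul, mul_diagonal, vecMulVec_apply, mulVec, vecMul, dotProduct]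
  ring

theorem transport_ndre_global_solution
    (n : ℕ) (hn : 1 ≤ n)
    (c α : ℝ) (hc : 0 < c ∧ c ≤ 1) (hα : 0 ≤ α ∧ α < 1)
    (ω cw : Fin n → ℝ)
    (hω : ∀ i, 0 < ω i ∧ ω i < 1) (hωanti : StrictAnti ω)
    (hcw : ∀ i, 0 < cw i) (hcwsum : ∑ i, cw i = 1)
    (Δ Γ : Matrix (Fin n) (Fin n) ℝ)
    (hΔ : Δ = Matrix.diagonal fun i => 1 / (c * ω i * (1 + α)))
    (hΓ : Γ = Matrix.diagonal fun i => 1 / (c * ω i * (1 - α)))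
    (e q : Fin n → ℝ)
    (he : e = fun _ => 1) (hq : q = fun i => cw i / (2 * ω i))
    (Xmin : Matrix (Fin n) (Fin n) ℝ)
    (hXmin_nonneg : ∀ i j, 0 ≤ Xmin i j)
    (hXmin_sol : -((Δ - vecMulVec e q) * Xmin) - Xmin * (Γ - vecMulVec q e)
        + Xmin * vecMulVec q q * Xmin + vecMulVec e e = 0)
    (hXmin_min : ∀ X' : Matrix (Fin n) (Fin n) ℝ, (∀ i j, 0 ≤ X' i j) →
      -((Δ - vecMulVec e q) * X') - X' * (Γ - vecMulVec q e)
        + X' * vecMulVec q q * X' + vecMulVec e e = 0 →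
      ∀ i j, Xmin i j ≤ X' i j)
    (X0 : Matrix (Fin n) (Fin n) ℝ)
    (hX0 : ∀ i j, 0 ≤ X0 i j ∧ X0 i j ≤ Xmin i j)
    (hX0' : ∀ i j, 0 ≤ (vecMulVec e e - Δ * X0 - X0 * Γ) i j) :
    ∃ X : ℝ → Matrix (Fin n) (Fin n) ℝ,
      X 0 = X0
      ∧ (∀ t ∈ Set.Ici (0 : ℝ),
          HasDerivWithinAt X
            (-((Δ - vecMulVec e q) * X t) - X t * (Γ - vecMulVec q e)
              + X t * vecMulVec q q * X t + vecMulVec e e)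
            (Set.Ici (0 : ℝ)) t)
      ∧ (∀ i j, MonotoneOn (fun t => X t i j) (Set.Ici (0 : ℝ)))
      ∧ Filter.Tendsto X Filter.atTop (nhds Xmin) := by
  subst hΔ hΓ he
  set d : Fin n → ℝ := fun i => 1 / (c * ω i * (1 + α))
  set g : Fin n → ℝ := fun i => 1 / (c * ω i * (1 - α))
  have hq0 (k : Fin n) : 0 ≤ q k := by
    rw [hq]
    exact div_nonneg (hcw k).le (by linarith [(hω k).1])
  let f : (Fin n × Fin n → ℝ) → Fin n × Fin n → ℝ := fun x p =>
    (1 + ∑ k, x (p.1, k) * q k) * (1 + ∑ k, q k * x (k, p.2)) - (d p.1 + g p.2) * x p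
  have hf : ContDiff ℝ 1 f := by
    refine contDiff_pi.2 fun p => ?_
    fun_prop
  have hX0nn (i j : Fin n) : 0 ≤ X0 i j := (hX0 i j).1
  obtain ⟨x, hx0, hx, hmono, l, ⟨hal, hlb⟩, hfl, hlim⟩ :=
    exists_monotone_solution_of_quasimonotone hf
      (a := fun p => X0 p.1 p.2) (b := fun p => Xmin p.1 p.2)
      (fun p => (hX0 p.1 p.2).2)
      (fun x y p hax hxy _ hp => by
        have hx (p) : 0 ≤ x p := (hX0nn p.1 p.2).trans (hax p)
        have hrow : ∑ k, x (p.1, k) * q k ≤ ∑ k, y (p.1, k) * q k :=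
          Finset.sum_le_sum fun k _ => mul_le_mul_of_nonneg_right (hxy _) (hq0 k)
        have hcol : ∑ k, q k * x (k, p.2) ≤ ∑ k, q k * y (k, p.2) :=
          Finset.sum_le_sum fun k _ => mul_le_mul_of_nonneg_left (hxy _) (hq0 k)
        have hrow0 : 0 ≤ ∑ k, x (p.1, k) * q k :=
          Finset.sum_nonneg fun k _ => mul_nonneg (hx _) (hq0 k)
        have hcol0 : 0 ≤ ∑ k, q k * x (k, p.2) :=
          Finset.sum_nonneg fun k _ => mul_nonneg (hq0 k) (hx _)
        have := mul_le_mul (add_le_add_right hrow 1) (add_le_add_right hcol 1)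
          (by linarith) (by linarith)
        simp only [f, hp]
        linarith)
      (fun p => by
        have h := hX0' p.1 p.2
        simp only [Matrix.sub_apply, diagonal_mul, mul_diagonal, vecMulVec_apply] at h
        have hrow0 : 0 ≤ ∑ k, X0 p.1 k * q k :=
          Finset.sum_nonneg fun k _ => mul_nonneg (hX0nn _ _) (hq0 k)
        have hcol0 : 0 ≤ ∑ k, q k * X0 k p.2 :=
          Finset.sum_nonneg fun k _ => mul_nonneg (hq0 k) (hX0nn _ _)
        simp only [f, Pi.zero_apply]
        nlinarith [mul_nonneg hrow0 hcol0])
      (fun p => by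
        have h := congrFun (congrFun hXmin_sol p.1) p.2
        rw [transport_riccati_apply] at h
        exact h.le)
  have hl : (fun p : Fin n × Fin n => Xmin p.1 p.2) = l := by
    refine le_antisymm (fun p => ?_) hlb
    refine hXmin_min (of fun i j => l (i, j)) (fun i j => (hX0nn i j).trans (hal (i, j))) ?_ p.1 p.2
    ext i j
    rw [transport_riccati_apply]
    exact congrFun hfl (i, j)
  refine ⟨fun t => of fun i j => x t (i, j), ?_, fun t ht => ?_, fun i j s _ t _ hst => ?_, ?_⟩
  · ext i j
    exact congrFun hx0 (i, j)
  · refine hasDerivWithinAt_pi.2 fun i => hasDerivWithinAt_pi.2 fun j => ?_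
    rw [transport_riccati_apply]
    exact (hasDerivAt_pi.1 (hx t ht) (i, j)).hasDerivWithinAt
  · exact hmono hst (i, j)
  · refine tendsto_pi_nhds.2 fun i => tendsto_pi_nhds.2 fun j => ?_
    have h := tendsto_pi_nhds.1 hlim (i, j)
    rwa [← hl] at h
end
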